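/- Let G=(V,E) be a connected finite simple graph with E nonempty, with a partition {B,R} of V, let d≥3 be an integer, D=binom(d+1,2) (so D≥6), and f(F)=D(|V(F)|−1)−|R(F)|. Then either (i) there exist three distinct vertices of G each of which lies in V(C) for exactly two P-connected components C of the polymatroid PM_f(G,{B,R}), or (ii) there exists a vertex of G that lies in V(C) for exactly one P-connected component C. -/

import Mathlib

/- STATEMENT 18: a connected simple graph with `D ≥ 6` has three distinct vertices each
spanned by exactly two P-connected components of `PM_f(G,{B,R})`, or a vertex spanned by
exactly one P-connected component. -/

set_option synthInstance.maxHeartbeats 1000000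
set_option maxHeartbeats 1000000

open scoped Classical

noncomputable section

/-- The set `V(F)` of vertices spanned by an edge set `F` in a multigraph whose edges `e : ε`
have endpoint pairs `π e : Sym2 V`. -/
def VF {V ε : Type} [Fintype V] (π : ε → Sym2 V) (F : Finset ε) : Finset V :=
  Finset.univ.filter (fun v => ∃ e ∈ F, v ∈ π e)

/-- The count function `f(F) = D·|V(F)| − D − |R(F)|`. -/
def fCnt {V ε : Type} [Fintype V] (D : ℕ) (π : ε → Sym2 V) (R : Finset V)
    (F : Finset ε) : ℤ :=
  (D : ℤ) * (VF π F).card - D - ((VF π F) ∩ R).card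

/-- Independence in the count matroid `M_f`: `|F'| ≤ f(F')` for all nonempty `F' ⊆ F`. -/
def CIndep {V ε : Type} [Fintype V] (D : ℕ) (π : ε → Sym2 V) (R : Finset V)
    (F : Finset ε) : Prop :=
  ∀ F' ⊆ F, F'.Nonempty → (F'.card : ℤ) ≤ fCnt D π R F'

/-- The rank function of the count matroid `M_f`: the maximum size of an independent subset. -/
def cRank {V ε : Type} [Fintype V] (D : ℕ) (π : ε → Sym2 V) (R : Finset V)
    (F : Finset ε) : ℕ :=
  sSup {n : ℕ | ∃ F' ⊆ F, CIndep D π R F' ∧ F'.card = n}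

/-- A circuit of the count matroid: a minimal dependent set. -/
def CCircuit {V ε : Type} [Fintype V] (D : ℕ) (π : ε → Sym2 V) (R : Finset V)
    (C : Finset ε) : Prop :=
  ¬ CIndep D π R C ∧ ∀ C' ⊂ C, CIndep D π R C'

/-- `F` is M-connected: every pair of its elements lies on a common circuit contained in `F`
(singletons and the empty set count as M-connected). -/
def MConn {V ε : Type} [Fintype V] (D : ℕ) (π : ε → Sym2 V) (R : Finset V)
    (F : Finset ε) : Prop :=
  F.card ≤ 1 ∨ ∀ e ∈ F, ∀ e' ∈ F, ∃ C ⊆ F, CCircuit D π R C ∧ e ∈ C ∧ e' ∈ C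

/-- `X` is an M-connected component of the count matroid restricted to the ground set `G`:
a maximal M-connected subset of `G`. -/
def MConnComp {V ε : Type} [Fintype V] (D : ℕ) (π : ε → Sym2 V) (R : Finset V)
    (G X : Finset ε) : Prop :=
  X ⊆ G ∧ MConn D π R X ∧ ∀ Y ⊆ G, MConn D π R Y → X ⊆ Y → Y = X

/-- `P` is a partition of `F` into nonempty parts. -/
def IsPartitionOf {ε : Type} [DecidableEq ε] (F : Finset ε) (P : Finset (Finset ε)) : Prop :=
  (∀ p ∈ P, p.Nonempty) ∧ (P : Set (Finset ε)).PairwiseDisjoint id ∧ P.biUnion id = F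

/-- The induced polymatroid function `f̂(F) = min Σᵢ f(Fᵢ)` over partitions of `F` into
nonempty parts (with `f̂(∅) = 0`). -/
def fHat {V ε : Type} [Fintype V] [DecidableEq ε] (D : ℕ) (π : ε → Sym2 V) (R : Finset V)
    (F : Finset ε) : ℤ :=
  sInf {s : ℤ | ∃ P : Finset (Finset ε), IsPartitionOf F P ∧ s = ∑ p ∈ P, fCnt D π R p}

/-- `F` is P-connected in the polymatroid `(E, f̂)`: no partition of `F` into at least two
nonempty parts satisfies `f̂(F) = Σᵢ f̂(Fᵢ)`. -/
def PConn {V ε : Type} [Fintype V] [DecidableEq ε] (D : ℕ) (π : ε → Sym2 V) (R : Finset V)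
    (F : Finset ε) : Prop :=
  F.Nonempty ∧ ∀ P : Finset (Finset ε), IsPartitionOf F P → 2 ≤ P.card →
    fHat D π R F ≠ ∑ p ∈ P, fHat D π R p

/-- `C` is a P-connected component of the polymatroid on the ground set `G`: a maximal
P-connected subset of `G`. -/
def PConnComp {V ε : Type} [Fintype V] [DecidableEq ε] (D : ℕ) (π : ε → Sym2 V) (R : Finset V)
    (G C : Finset ε) : Prop :=
  C ⊆ G ∧ PConn D π R C ∧ ∀ C' ⊆ G, PConn D π R C' → C ⊆ C' → C' = C

/-- The multiplicity `f({e}) = D − |R({e})|` of an edge in `f∘G`. -/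
def fMult {V ε : Type} [Fintype V] (D : ℕ) (π : ε → Sym2 V) (R : Finset V) (e : ε) : ℕ :=
  D - ((VF π ({e} : Finset ε)) ∩ R).card

/-- The set `f∘F` of all copies of edges of `F` in `f∘G`; copies of `e` are indexed by
`i : Fin D` with `i < f({e})`. -/
def fCopy {V ε : Type} [Fintype V] [DecidableEq ε] (D : ℕ) (π : ε → Sym2 V) (R : Finset V)
    (F : Finset ε) : Finset (ε × Fin D) :=
  F.biUnion (fun e =>
    ({e} : Finset ε) ×ˢ (Finset.univ.filter (fun i : Fin D => (i : ℕ) < fMult D π R e)))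

end

noncomputable def S18_w {V : Type} (D : ℕ) (R : Finset V) (v : V) : ℤ := (D : ℤ) - if v ∈ R then 1 else 0

theorem S18_fCnt_eq {V ε : Type} [Fintype V] (D : ℕ) (π : ε → Sym2 V) (R : Finset V)
    (F : Finset ε) :
    fCnt D π R F = ∑ v ∈ VF π F, S18_w D R v - D := by
  unfold fCnt S18_w
  rw [Finset.sum_sub_distrib, Finset.sum_const, Finset.sum_ite_mem]
  simp
  ring

theorem S18_submod {V ε : Type} [Fintype V] [DecidableEq ε] (D : ℕ) (hD : 1 ≤ D)
    (π : ε → Sym2 V) (R : Finset V) (A B : Finset ε) :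
    fCnt D π R (A ∪ B) + fCnt D π R (A ∩ B) ≤ fCnt D π R A + fCnt D π R B := by
  simp only [S18_fCnt_eq]
  have h1 : VF π (A ∪ B) = VF π A ∪ VF π B := by
    ext v
    simp only [VF, Finset.mem_filter, Finset.mem_univ, true_and, Finset.mem_union]
    constructor
    · rintro ⟨e, h | h, hv⟩
      · exact Or.inl ⟨e, h, hv⟩
      · exact Or.inr ⟨e, h, hv⟩
    · rintro (⟨e, h, hv⟩ | ⟨e, h, hv⟩)
      · exact ⟨e, Or.inl h, hv⟩
      · exact ⟨e, Or.inr h, hv⟩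
  have h2 : VF π (A ∩ B) ⊆ VF π A ∩ VF π B := by
    intro v
    simp only [VF, Finset.mem_filter, Finset.mem_univ, true_and, Finset.mem_inter]
    rintro ⟨e, ⟨ha, hb⟩, hv⟩
    exact ⟨⟨e, ha, hv⟩, ⟨e, hb, hv⟩⟩
  have h3 : ∑ v ∈ VF π (A ∩ B), S18_w D R v
      ≤ ∑ v ∈ VF π A ∩ VF π B, S18_w D R v := by
    apply Finset.sum_le_sum_of_subset_of_nonneg h2
    intro v _ _
    unfold S18_w; split_ifs <;> omega
  have h4 := Finset.sum_union_inter (s₁ := VF π A) (s₂ := VF π B)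
    (f := fun v => S18_w D R v)
  rw [h1]
  linarith

theorem S18_part_single {ε : Type} [DecidableEq ε] (F : Finset ε) (hF : F.Nonempty) :
    IsPartitionOf F {F} := by
  refine ⟨by simpa using hF, by simp, by simp⟩

theorem S18_part_exists {ε : Type} [DecidableEq ε] (F : Finset ε) :
    ∃ P, IsPartitionOf F P := by
  rcases F.eq_empty_or_nonempty with rfl | h
  · exact ⟨∅, by simp [IsPartitionOf]⟩
  · exact ⟨_, S18_part_single F h⟩

theorem S18_part_sub {ε : Type} [DecidableEq ε] {F : Finset ε} {P : Finset (Finset ε)}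
    (h : IsPartitionOf F P) {p : Finset ε} (hp : p ∈ P) : p ⊆ F := by
  rw [← h.2.2]
  exact Finset.subset_biUnion_of_mem id hp

theorem S18_part_finite {ε : Type} [DecidableEq ε] (F : Finset ε) :
    {P | IsPartitionOf F P}.Finite := by
  apply (Finset.finite_toSet F.powerset.powerset).subset
  intro P hP
  rw [Finset.mem_coe, Finset.mem_powerset]
  intro p hp
  exact Finset.mem_powerset.2 (S18_part_sub hP hp)

theorem S18_setfin {V ε : Type} [Fintype V] [DecidableEq ε] (D : ℕ)
    (π : ε → Sym2 V) (R : Finset V) (F : Finset ε) :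
    {s : ℤ | ∃ P : Finset (Finset ε), IsPartitionOf F P ∧ s = ∑ p ∈ P, fCnt D π R p}.Finite := by
  refine ((S18_part_finite F).image (fun P => ∑ p ∈ P, fCnt D π R p)).subset ?_
  rintro s ⟨P, hP, rfl⟩
  exact ⟨P, hP, rfl⟩

theorem S18_le {V ε : Type} [Fintype V] [DecidableEq ε] (D : ℕ)
    (π : ε → Sym2 V) (R : Finset V) (F : Finset ε) (P : Finset (Finset ε))
    (hP : IsPartitionOf F P) : fHat D π R F ≤ ∑ p ∈ P, fCnt D π R p :=
  csInf_le (S18_setfin D π R F).bddBelow ⟨P, hP, rfl⟩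

theorem S18_att {V ε : Type} [Fintype V] [DecidableEq ε] (D : ℕ)
    (π : ε → Sym2 V) (R : Finset V) (F : Finset ε) :
    ∃ P, IsPartitionOf F P ∧ fHat D π R F = ∑ p ∈ P, fCnt D π R p := by
  obtain ⟨P, hP⟩ := S18_part_exists F
  exact Int.csInf_mem (s := {s : ℤ | ∃ P : Finset (Finset ε), IsPartitionOf F P ∧
    s = ∑ p ∈ P, fCnt D π R p}) ⟨_, P, hP, rfl⟩ (S18_setfin D π R F).bddBelow

theorem S18_refine {ε : Type} [DecidableEq ε] {F : Finset ε} {P : Finset (Finset ε)}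
    (h : IsPartitionOf F P) (T : Finset ε → Finset (Finset ε))
    (hT : ∀ p ∈ P, IsPartitionOf p (T p)) :
    IsPartitionOf F (P.biUnion T) ∧ (P : Set (Finset ε)).PairwiseDisjoint T := by
  have key : ∀ p ∈ P, ∀ q ∈ P, ∀ x ∈ T p, ∀ e ∈ x, e ∈ q → p = q := by
    intro p hp q hq x hx e he heq
    by_contra hne
    exact Finset.disjoint_left.1 (h.2.1 hp hq hne) (S18_part_sub (hT p hp) hx he) heq
  refine ⟨⟨?_, ?_, ?_⟩, ?_⟩
  · intro x hx
    obtain ⟨p, hp, hx⟩ := Finset.mem_biUnion.1 hx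
    exact (hT p hp).1 x hx
  · intro x hx y hy hxy
    obtain ⟨p, hp, hx⟩ := Finset.mem_biUnion.1 (Finset.mem_coe.1 hx)
    obtain ⟨q, hq, hy⟩ := Finset.mem_biUnion.1 (Finset.mem_coe.1 hy)
    refine Finset.disjoint_left.2 fun e he he' => ?_
    have : p = q := key p hp q hq x hx e he (S18_part_sub (hT q hq) hy he')
    subst this
    exact Finset.disjoint_left.1 ((hT p hp).2.1 hx hy hxy) he he'
  · ext e
    rw [← h.2.2]
    simp only [Finset.mem_biUnion, id]
    constructor
    · rintro ⟨x, ⟨p, hp, hx⟩, he⟩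
      exact ⟨p, hp, S18_part_sub (hT p hp) hx he⟩
    · rintro ⟨p, hp, he⟩
      rw [← (hT p hp).2.2] at he
      obtain ⟨x, hx, he⟩ := Finset.mem_biUnion.1 he
      exact ⟨x, ⟨p, hp, hx⟩, he⟩
  · intro p hp q hq hne
    refine Finset.disjoint_left.2 fun x hx hx' => hne ?_
    obtain ⟨e, he⟩ := (hT p hp).1 x hx
    exact key p hp q hq x hx e he (S18_part_sub (hT q hq) hx' he)

theorem S18_subadd {V ε : Type} [Fintype V] [DecidableEq ε] (D : ℕ)
    (π : ε → Sym2 V) (R : Finset V) (F : Finset ε) (P : Finset (Finset ε))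
    (hP : IsPartitionOf F P) :
    ∃ Q, IsPartitionOf F Q ∧ P.card ≤ Q.card ∧
      ∑ q ∈ Q, fCnt D π R q = ∑ p ∈ P, fHat D π R p := by
  choose T hT hT2 using fun p => S18_att D π R p
  obtain ⟨h1, h2⟩ := S18_refine hP T (fun p _ => hT p)
  refine ⟨_, h1, ?_, ?_⟩
  · rw [Finset.card_biUnion h2, Finset.card_eq_sum_ones]
    apply Finset.sum_le_sum
    intro p hp
    rw [Nat.succ_le_iff, Finset.card_pos, Finset.nonempty_iff_ne_empty]
    intro h0
    have := (hT p).2.2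
    rw [h0] at this
    have h3 := hP.1 p hp
    rw [← this] at h3
    simp at h3
  · rw [Finset.sum_biUnion h2]
    exact Finset.sum_congr rfl fun p _ => (hT2 p).symm

theorem S18_conn_eq {V ε : Type} [Fintype V] [DecidableEq ε] (D : ℕ)
    (π : ε → Sym2 V) (R : Finset V) (X : Finset ε) (hX : PConn D π R X) :
    fHat D π R X = fCnt D π R X := by
  obtain ⟨P, hP, h⟩ := S18_att D π R X
  by_cases hc : 2 ≤ P.card
  · exfalso
    apply hX.2 P hP hc
    apply le_antisymm
    · obtain ⟨Q, hQ, -, h2⟩ := S18_subadd D π R X P hP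
      rw [← h2]
      exact S18_le D π R X Q hQ
    · rw [h]
      apply Finset.sum_le_sum
      intro p hp
      simpa using S18_le D π R p {p} (S18_part_single p (hP.1 p hp))
  · have h0 : P.card = 1 := by
      have : P.card ≠ 0 := by
        intro h0
        have h1 := hP.2.2
        rw [Finset.card_eq_zero.1 h0] at h1
        have h3 := hX.1
        rw [← h1] at h3
        simp at h3
      omega
    obtain ⟨p, rfl⟩ := Finset.card_eq_one.1 h0
    have := hP.2.2
    simp at this
    subst this
    simpa using h

theorem S18_uncross {V ε : Type} [Fintype V] [DecidableEq ε] (D : ℕ) (hD : 1 ≤ D)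
    (π : ε → Sym2 V) (R : Finset V) (X : Finset ε) (S : Finset (Finset ε))
    (hS : (S : Set (Finset ε)).PairwiseDisjoint id) :
    fCnt D π R (X ∪ S.biUnion id) + ∑ p ∈ S, fCnt D π R (X ∩ p) ≤
      fCnt D π R X + ∑ p ∈ S, fCnt D π R p := by
  induction S using Finset.induction_on with
  | empty => simp
  | insert p S hp ih =>
    rw [Finset.sum_insert hp, Finset.sum_insert hp, Finset.biUnion_insert]
    have ih := ih (hS.subset (by simp))
    have hsub := S18_submod D hD π R (X ∪ S.biUnion id) p
    have e1 : X ∪ S.biUnion id ∪ p = X ∪ (id p ∪ S.biUnion id) := by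
      simp only [id]
      rw [Finset.union_assoc, Finset.union_comm p]
    have e2 : (X ∪ S.biUnion id) ∩ p = X ∩ p := by
      ext e
      simp only [Finset.mem_inter, Finset.mem_union, Finset.mem_biUnion, id]
      constructor
      · rintro ⟨h | ⟨q, hq, heq⟩, hep⟩
        · exact ⟨h, hep⟩
        · exfalso
          have hne : q ≠ p := fun h => hp (h ▸ hq)
          exact Finset.disjoint_left.1 (hS (by simp [hq]) (by simp) hne) heq hep
      · rintro ⟨h, hep⟩
        exact ⟨Or.inl h, hep⟩
    rw [e1, e2] at hsub
    linarith

theorem S18_main {V ε : Type} [Fintype V] [DecidableEq ε] (D : ℕ) (hD : 1 ≤ D)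
    (π : ε → Sym2 V) (R : Finset V) (E : Finset ε) (hE : E.Nonempty) :
    ∃ P, IsPartitionOf E P ∧ (∀ C, PConnComp D π R E C ↔ C ∈ P) ∧
      ∑ p ∈ P, fCnt D π R p ≤ fCnt D π R E := by
  obtain ⟨P₀, hP₀, h₀⟩ := S18_att D π R E
  have hfin : {P | IsPartitionOf E P ∧ fHat D π R E = ∑ p ∈ P, fCnt D π R p}.Finite :=
    (S18_part_finite E).subset fun P hP => hP.1
  obtain ⟨P, ⟨hP, hval⟩, hmax⟩ := Set.exists_max_image _ Finset.card hfin ⟨P₀, hP₀, h₀⟩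
  -- parts are P-connected
  have hconn : ∀ p ∈ P, PConn D π R p := by
    intro p hp
    refine ⟨hP.1 p hp, fun Q hQ hc heq => ?_⟩
    obtain ⟨Q', hQ', hc', hs'⟩ := S18_subadd D π R p Q hQ
    have hle : ∑ q ∈ Q', fCnt D π R q ≤ fCnt D π R p := by
      rw [hs', ← heq]
      simpa using S18_le D π R p {p} (S18_part_single p (hP.1 p hp))
    let T : Finset ε → Finset (Finset ε) := fun x => if x = p then Q' else {x}
    obtain ⟨h1, h2⟩ := S18_refine hP T (by
      intro x hx
      by_cases hxp : x = p
      · subst hxp; simpa [T] using hQ'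
      · simpa [T, hxp] using S18_part_single x (hP.1 x hx))
    have hsum : ∑ q ∈ P.biUnion T, fCnt D π R q ≤ ∑ p ∈ P, fCnt D π R p := by
      rw [Finset.sum_biUnion h2]
      apply Finset.sum_le_sum
      intro x hx
      by_cases hxp : x = p
      · subst hxp; simpa [T] using hle
      · simp [T, hxp]
    have hcard : P.card < (P.biUnion T).card := by
      rw [Finset.card_biUnion h2, Finset.card_eq_sum_ones]
      apply Finset.sum_lt_sum
      · intro x hx
        by_cases hxp : x = p
        · subst hxp; simp only [T, if_true]; omega
        · simp [T, hxp]
      · refine ⟨p, hp, ?_⟩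
        simp only [T, if_true]; omega
    have hl := S18_le D π R E _ h1
    have := hmax (P.biUnion T) ⟨h1, by linarith⟩
    omega
  have hopt : ∀ S ⊆ P, S.Nonempty → ∑ p ∈ S, fCnt D π R p ≤ fCnt D π R (S.biUnion id) := by
    intro S hS hne
    have hdis : ∀ q ∈ P \ S, Disjoint q (S.biUnion id) := by
      intro q hq
      rw [Finset.mem_sdiff] at hq
      rw [Finset.disjoint_biUnion_right]
      intro s hs
      exact hP.2.1 hq.1 (hS hs) (fun h => hq.2 (h ▸ hs))
    have hneU : (S.biUnion id).Nonempty := by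
      obtain ⟨s, hs⟩ := hne
      obtain ⟨e, he⟩ := hP.1 s (hS hs)
      exact ⟨e, Finset.mem_biUnion.2 ⟨s, hs, he⟩⟩
    have hnot : S.biUnion id ∉ P \ S := by
      intro h
      have := hdis _ h
      rw [disjoint_self] at this
      exact hneU.ne_empty this
    have hpart : IsPartitionOf E (insert (S.biUnion id) (P \ S)) := by
      refine ⟨?_, ?_, ?_⟩
      · intro x hx
        rcases Finset.mem_insert.1 hx with rfl | hx
        · exact hneU
        · exact hP.1 x (Finset.mem_sdiff.1 hx).1
      · intro x hx y hy hxy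
        rcases Finset.mem_insert.1 (Finset.mem_coe.1 hx) with hx | hx <;>
        rcases Finset.mem_insert.1 (Finset.mem_coe.1 hy) with hy | hy
        · exact absurd (hx.trans hy.symm) hxy
        · subst hx; exact (hdis y hy).symm
        · subst hy; exact hdis x hx
        · exact hP.2.1 (Finset.mem_sdiff.1 hx).1 (Finset.mem_sdiff.1 hy).1 hxy
      · rw [← hP.2.2, Finset.biUnion_insert]
        conv_rhs => rw [← Finset.union_sdiff_of_subset hS]
        rw [Finset.union_biUnion]
        rfl
    have := S18_le D π R E _ hpart
    rw [Finset.sum_insert hnot, hval, ← Finset.sum_sdiff hS] at this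
    linarith
  have hin : ∀ X ⊆ E, PConn D π R X → ∃ p ∈ P, X ⊆ p := by
    intro X hXE hX
    set S := P.filter (fun p => (X ∩ p).Nonempty) with hSdef
    have hSP : S ⊆ P := Finset.filter_subset _ _
    have hXS : X ⊆ S.biUnion id := by
      intro e he
      have h1 := hXE he
      rw [← hP.2.2] at h1
      obtain ⟨p, hp, hep⟩ := Finset.mem_biUnion.1 h1
      exact Finset.mem_biUnion.2 ⟨p, Finset.mem_filter.2 ⟨hp, e, Finset.mem_inter.2 ⟨he, hep⟩⟩, hep⟩
    have hSne : S.Nonempty := by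
      obtain ⟨e, he⟩ := hX.1
      obtain ⟨p, hp, -⟩ := Finset.mem_biUnion.1 (hXS he)
      exact ⟨p, hp⟩
    have hSd : (S : Set (Finset ε)).PairwiseDisjoint id := hP.2.1.subset (by exact_mod_cast hSP)
    by_cases hc : 2 ≤ S.card
    · exfalso
      have hu := S18_uncross D hD π R X S hSd
      rw [Finset.union_eq_right.2 hXS] at hu
      have ho := hopt S hSP hSne
      have hinj : Set.InjOn (fun p => X ∩ p) (S : Set (Finset ε)) := by
        intro p hp q hq hpq
        by_contra hne
        obtain ⟨e, he⟩ := (Finset.mem_filter.1 (Finset.mem_coe.1 hp)).2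
        have he' := he
        simp only at hpq
        rw [hpq] at he'
        exact Finset.disjoint_left.1 (hSd hp hq hne) (Finset.mem_inter.1 he).2
          (Finset.mem_inter.1 he').2
      have hpart : IsPartitionOf X (S.image (fun p => X ∩ p)) := by
        refine ⟨?_, ?_, ?_⟩
        · intro x hx
          obtain ⟨p, hp, rfl⟩ := Finset.mem_image.1 hx
          exact (Finset.mem_filter.1 hp).2
        · intro x hx y hy hxy
          obtain ⟨p, hp, rfl⟩ := Finset.mem_image.1 (Finset.mem_coe.1 hx)
          obtain ⟨q, hq, rfl⟩ := Finset.mem_image.1 (Finset.mem_coe.1 hy)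
          have hne : p ≠ q := fun h => hxy (by rw [h])
          exact Finset.disjoint_of_subset_left Finset.inter_subset_right
            (Finset.disjoint_of_subset_right Finset.inter_subset_right (hSd hp hq hne))
        · ext e
          simp only [Finset.mem_biUnion, Finset.mem_image, id]
          constructor
          · rintro ⟨_, ⟨p, _, rfl⟩, he⟩
            exact (Finset.mem_inter.1 he).1
          · intro he
            obtain ⟨p, hp, hep⟩ := Finset.mem_biUnion.1 (hXS he)
            exact ⟨_, ⟨p, hp, rfl⟩, Finset.mem_inter.2 ⟨he, hep⟩⟩
      apply hX.2 _ hpart (by rw [Finset.card_image_of_injOn hinj]; exact hc)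
      apply le_antisymm
      · obtain ⟨Q, hQ, -, h2⟩ := S18_subadd D π R X _ hpart
        rw [← h2]
        exact S18_le D π R X Q hQ
      · rw [S18_conn_eq D π R X hX]
        have h1 : ∑ p ∈ S.image (fun p => X ∩ p), fHat D π R p ≤
            ∑ p ∈ S.image (fun p => X ∩ p), fCnt D π R p := by
          apply Finset.sum_le_sum
          intro p hp
          simpa using S18_le D π R p {p} (S18_part_single p (hpart.1 p hp))
        rw [Finset.sum_image (g := fun p => X ∩ p) (f := fun p => fCnt D π R p) hinj] at h1
        linarith
    · have hc1 : S.card = 1 := by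
        have := Finset.card_pos.2 hSne
        omega
      obtain ⟨p, hp⟩ := Finset.card_eq_one.1 hc1
      refine ⟨p, hSP (by rw [hp]; simp), ?_⟩
      rw [hp] at hXS
      simpa using hXS
  refine ⟨P, hP, ?_, ?_⟩
  · intro C
    constructor
    · rintro ⟨hCE, hC, hCm⟩
      obtain ⟨p, hp, hCp⟩ := hin C hCE hC
      have := hCm p (S18_part_sub hP hp) (hconn p hp) hCp
      exact this ▸ hp
    · intro hC
      refine ⟨S18_part_sub hP hC, hconn C hC, fun C' hC'E hC' hsub => ?_⟩
      obtain ⟨p, hp, hp'⟩ := hin C' hC'E hC'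
      have : C = p := by
        by_contra hne
        obtain ⟨e, he⟩ := hP.1 C hC
        exact Finset.disjoint_left.1 (hP.2.1 hC hp hne) he (hp' (hsub he))
      subst this
      exact Finset.Subset.antisymm hp' hsub
  · rw [← hval]
    simpa using S18_le D π R E {E} (S18_part_single E hE)

theorem statement_18
    (V : Type) [Fintype V] [DecidableEq V]
    (G : SimpleGraph V) [DecidableRel G.Adj] (hconn : G.Connected)
    (hE : G.edgeFinset.Nonempty)
    (B R : Finset V) (hdisj : Disjoint B R) (hcov : B ∪ R = Finset.univ)
    (d D : ℕ) (hd : 3 ≤ d) (hD : D = (d + 1).choose 2) :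
    (∃ v₁ v₂ v₃ : V, v₁ ≠ v₂ ∧ v₁ ≠ v₃ ∧ v₂ ≠ v₃ ∧
      ∀ v ∈ ({v₁, v₂, v₃} : Finset V),
        {C : Finset (Sym2 V) |
          PConnComp D (id : Sym2 V → Sym2 V) R G.edgeFinset C ∧ v ∈ VF id C}.ncard = 2) ∨
    (∃ v : V,
      {C : Finset (Sym2 V) |
        PConnComp D (id : Sym2 V → Sym2 V) R G.edgeFinset C ∧ v ∈ VF id C}.ncard = 1) := by
  have hD6 : 6 ≤ D := by
    rw [hD]
    calc 6 = (3 + 1).choose 2 := by decide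
      _ ≤ (d + 1).choose 2 := Nat.choose_le_choose 2 (by omega)
  obtain ⟨P, hP, hcomp, hsum⟩ := S18_main D (by omega) (id : Sym2 V → Sym2 V) R G.edgeFinset hE
  set m : V → ℕ := fun v => (P.filter (fun C => v ∈ VF id C)).card with hm
  have hn : ∀ v, {C : Finset (Sym2 V) |
      PConnComp D (id : Sym2 V → Sym2 V) R G.edgeFinset C ∧ v ∈ VF id C}.ncard = m v := by
    intro v
    simp only [hm]
    rw [← Set.ncard_coe_finset]
    congr 1
    ext C
    simp only [Set.mem_setOf_eq, Finset.coe_filter]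
    rw [hcomp]
  simp only [hn]
  by_contra hcon
  push Not at hcon
  obtain ⟨h3, h1⟩ := hcon
  have hnt : Nontrivial V := by
    obtain ⟨e, he⟩ := hE
    induction e using Sym2.ind with
    | _ a b =>
      rw [SimpleGraph.mem_edgeFinset, SimpleGraph.mem_edgeSet] at he
      exact ⟨a, b, he.ne⟩
  have hm1 : ∀ v, 1 ≤ m v := by
    intro v
    obtain ⟨u, hu⟩ := (G.degree_pos_iff_exists_adj v).1
      (hconn.preconnected.degree_pos_of_nontrivial v)
    have he : s(v, u) ∈ G.edgeFinset := by
      rw [SimpleGraph.mem_edgeFinset, SimpleGraph.mem_edgeSet]; exact hu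
    rw [← hP.2.2] at he
    obtain ⟨p, hp, hep⟩ := Finset.mem_biUnion.1 he
    apply Nat.succ_le_of_lt
    apply Finset.card_pos.2
    refine ⟨p, Finset.mem_filter.2 ⟨hp, ?_⟩⟩
    simp only [VF, Finset.mem_filter, Finset.mem_univ, true_and, id]
    exact ⟨_, hep, by simp⟩
  have hm2 : ∀ v, 2 ≤ m v := fun v => by
    have := hm1 v
    have := h1 v
    omega
  have hfew : (Finset.univ.filter (fun v => m v = 2)).card ≤ 2 := by
    by_contra hc
    obtain ⟨a, b, c, ha, hb, hc, hab, hac, hbc⟩ := Finset.two_lt_card_iff.1 (not_le.1 hc)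
    obtain ⟨v, hv, hv'⟩ := h3 a b c hab hac hbc
    simp only [Finset.mem_filter, Finset.mem_univ, true_and] at ha hb hc
    simp only [Finset.mem_insert, Finset.mem_singleton] at hv
    rcases hv with rfl | rfl | rfl <;> contradiction
  -- double counting
  have hdc : ∀ g : V → ℤ, ∑ p ∈ P, ∑ v ∈ VF id p, g v = ∑ v, (m v : ℤ) * g v := by
    intro g
    have : ∀ p ∈ P, ∑ v ∈ VF id p, g v = ∑ v, if v ∈ VF id p then g v else 0 := by
      intro p _
      rw [Finset.sum_ite_mem, Finset.univ_inter]
    rw [Finset.sum_congr rfl this, Finset.sum_comm]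
    apply Finset.sum_congr rfl
    intro v _
    rw [← Finset.sum_filter, Finset.sum_const, nsmul_eq_mul]
  have hcard2 : ∀ p ∈ P, 2 ≤ (VF id p).card := by
    intro p hp
    obtain ⟨e, he⟩ := hP.1 p hp
    have heE := S18_part_sub hP hp he
    induction e using Sym2.ind with
    | _ a b =>
      rw [SimpleGraph.mem_edgeFinset, SimpleGraph.mem_edgeSet] at heE
      apply Finset.one_lt_card.2
      refine ⟨a, ?_, b, ?_, heE.ne⟩
      · simp only [VF, Finset.mem_filter, Finset.mem_univ, true_and, id]
        exact ⟨_, he, by simp⟩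
      · simp only [VF, Finset.mem_filter, Finset.mem_univ, true_and, id]
        exact ⟨_, he, by simp⟩
  have hsm : 2 * (P.card : ℤ) ≤ ∑ v, (m v : ℤ) := by
    have h := hdc (fun _ => 1)
    simp only [mul_one] at h
    rw [← h, mul_comm, ← nsmul_eq_mul]
    apply Finset.card_nsmul_le_sum
    intro p hp
    have := hcard2 p hp
    simp only [Finset.sum_const, nsmul_eq_mul, mul_one]
    exact_mod_cast this
  simp only [S18_fCnt_eq] at hsum
  rw [Finset.sum_sub_distrib, hdc, Finset.sum_const, nsmul_eq_mul] at hsum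
  have hE2 : ∑ v ∈ VF id G.edgeFinset, S18_w D R v ≤
      ∑ v, S18_w D R v := by
    apply Finset.sum_le_sum_of_subset_of_nonneg (Finset.subset_univ _)
    intro v _ _
    unfold S18_w; split_ifs <;> omega
  have hlow : ((D : ℤ) - 1) * ∑ v, ((m v : ℤ) - 1) ≤
      ∑ v, (m v : ℤ) * S18_w D R v -
        ∑ v, S18_w D R v := by
    rw [← Finset.sum_sub_distrib, Finset.mul_sum]
    apply Finset.sum_le_sum
    intro v _
    have := hm2 v
    unfold S18_w
    split_ifs
    · apply le_of_eq; ring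
    · have : (2 : ℤ) ≤ m v := by exact_mod_cast this
      nlinarith
  have h32 : 2 * ∑ v, (m v : ℤ) - 2 ≤ 3 * ∑ v, ((m v : ℤ) - 1) := by
    have hf : (∑ v, if m v = 2 then (1 : ℤ) else 0) ≤ 2 := by
      rw [← Finset.sum_filter]
      simp only [Finset.sum_const, nsmul_eq_mul, mul_one]
      exact_mod_cast hfew
    have : 2 * ∑ v, (m v : ℤ) - (∑ v, if m v = 2 then (1 : ℤ) else 0) ≤
        3 * ∑ v, ((m v : ℤ) - 1) := by
      rw [Finset.mul_sum, Finset.mul_sum, ← Finset.sum_sub_distrib]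
      apply Finset.sum_le_sum
      intro v _
      have := hm2 v
      split_ifs <;> omega
    linarith
  have hk : (0 : ℤ) ≤ P.card := by positivity
  have hD6' : (6 : ℤ) ≤ D := by exact_mod_cast hD6
  have hA : 4 * (P.card : ℤ) - 2 ≤ 3 * ∑ v, ((m v : ℤ) - 1) := by linarith
  have hB : ((D : ℤ) - 1) * ∑ v, ((m v : ℤ) - 1) ≤ P.card * D - D := by linarith
  have hC := mul_le_mul_of_nonneg_left hA (show (0 : ℤ) ≤ (D : ℤ) - 1 by linarith)
  nlinarith
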